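/- Monotone increasing convergence of the modified Newton iteration: Assume the sign conditions hold, the kernel condition holds, (A, B) is stabilizable, and (Q − L R⁻¹ Lᵀ, A) is detectable. Suppose X_* ∈ ℝ^{n×n} is symmetric positive semidefinite with 𝓡(X_*) = 0 and is the unique symmetric positive semidefinite solution of 𝓡(X) = 0, and suppose there exists α > 0 such that 𝓕_{X_*}(Z) ⪰ α Z for every symmetric Z ⪰ 0. Let X_0 be symmetric with 0 ⪯ X_0 ⪯ X_*, 𝓡(X_0) ⪰ 0, and such that F_W(Y) − (Y − W) B R⁻¹ Bᵀ (Y − W) ⪰ 0 holds for all symmetric W, Y with X_0 ⪯ W ⪯ Y ⪯ X_*. Let (X_k)_{k≥0} be symmetric n×n matrices such that for every k ≥ 0: A_c(X_k)ᵀ X_{k+1} + X_{k+1} A_c(X_k) − X_{k+1} G_c(X_k) X_{k+1} + H_c(X_k) + (X_{k+1} − X_k) G_c(X_k) (X_{k+1} − X_k) = 0, and assume X_k ⪰ 0 for all k. Then: (a) X_k ⪯ X_{k+1} ⪯ X_* and 𝓡(X_k) ⪰ 0 for every k ≥ 0; (b) X_k converges to X_* as k → ∞. -/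

import Mathlib

open Matrix Filter

noncomputable section

/-- `Π₁₁(X) = Σᵢ (A₀ⁱ)ᵀ X A₀ⁱ`. -/
def Pi11 {n r : ℕ} (A0 : Fin r → Matrix (Fin n) (Fin n) ℝ)
    (X : Matrix (Fin n) (Fin n) ℝ) : Matrix (Fin n) (Fin n) ℝ :=
  ∑ i, (A0 i)ᵀ * X * A0 i

/-- `Π₁₂(X) = Σᵢ (A₀ⁱ)ᵀ X B₀ⁱ`. -/
def Pi12 {n m r : ℕ} (A0 : Fin r → Matrix (Fin n) (Fin n) ℝ)
    (B0 : Fin r → Matrix (Fin n) (Fin m) ℝ)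
    (X : Matrix (Fin n) (Fin n) ℝ) : Matrix (Fin n) (Fin m) ℝ :=
  ∑ i, (A0 i)ᵀ * X * B0 i

/-- `Π₂₂(X) = Σᵢ (B₀ⁱ)ᵀ X B₀ⁱ`. -/
def Pi22 {n m r : ℕ} (B0 : Fin r → Matrix (Fin n) (Fin m) ℝ)
    (X : Matrix (Fin n) (Fin n) ℝ) : Matrix (Fin m) (Fin m) ℝ :=
  ∑ i, (B0 i)ᵀ * X * B0 i

/-- The block matrix `Π(X) = [Π₁₁(X), Π₁₂(X); Π₁₂(X)ᵀ, Π₂₂(X)]`. -/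
def PiBlock {n m r : ℕ} (A0 : Fin r → Matrix (Fin n) (Fin n) ℝ)
    (B0 : Fin r → Matrix (Fin n) (Fin m) ℝ)
    (X : Matrix (Fin n) (Fin n) ℝ) : Matrix (Fin n ⊕ Fin m) (Fin n ⊕ Fin m) ℝ :=
  fromBlocks (Pi11 A0 X) (Pi12 A0 B0 X) (Pi12 A0 B0 X)ᵀ (Pi22 B0 X)

/-- `L_c(X) = L + Π₁₂(X)`. -/
def Lc {n m r : ℕ} (L : Matrix (Fin n) (Fin m) ℝ)
    (A0 : Fin r → Matrix (Fin n) (Fin n) ℝ) (B0 : Fin r → Matrix (Fin n) (Fin m) ℝ)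
    (X : Matrix (Fin n) (Fin n) ℝ) : Matrix (Fin n) (Fin m) ℝ :=
  L + Pi12 A0 B0 X

/-- `R_c(X) = R + Π₂₂(X)`. -/
def Rc {n m r : ℕ} (R : Matrix (Fin m) (Fin m) ℝ)
    (B0 : Fin r → Matrix (Fin n) (Fin m) ℝ)
    (X : Matrix (Fin n) (Fin n) ℝ) : Matrix (Fin m) (Fin m) ℝ :=
  R + Pi22 B0 X

/-- `Q_c(X) = Q + Π₁₁(X)`. -/
def Qc {n r : ℕ} (Q : Matrix (Fin n) (Fin n) ℝ)
    (A0 : Fin r → Matrix (Fin n) (Fin n) ℝ)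
    (X : Matrix (Fin n) (Fin n) ℝ) : Matrix (Fin n) (Fin n) ℝ :=
  Q + Pi11 A0 X

/-- `A_c(X) = A − B R_c(X)⁻¹ L_c(X)ᵀ`. -/
def Ac {n m r : ℕ} (A : Matrix (Fin n) (Fin n) ℝ) (B : Matrix (Fin n) (Fin m) ℝ)
    (L : Matrix (Fin n) (Fin m) ℝ) (R : Matrix (Fin m) (Fin m) ℝ)
    (A0 : Fin r → Matrix (Fin n) (Fin n) ℝ) (B0 : Fin r → Matrix (Fin n) (Fin m) ℝ)
    (X : Matrix (Fin n) (Fin n) ℝ) : Matrix (Fin n) (Fin n) ℝ :=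
  A - B * (Rc R B0 X)⁻¹ * (Lc L A0 B0 X)ᵀ

/-- `G_c(X) = B R_c(X)⁻¹ Bᵀ`. -/
def Gc {n m r : ℕ} (B : Matrix (Fin n) (Fin m) ℝ) (R : Matrix (Fin m) (Fin m) ℝ)
    (B0 : Fin r → Matrix (Fin n) (Fin m) ℝ)
    (X : Matrix (Fin n) (Fin n) ℝ) : Matrix (Fin n) (Fin n) ℝ :=
  B * (Rc R B0 X)⁻¹ * Bᵀ

/-- `H_c(X) = Q_c(X) − L_c(X) R_c(X)⁻¹ L_c(X)ᵀ`. -/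
def Hc {n m r : ℕ} (Q : Matrix (Fin n) (Fin n) ℝ) (L : Matrix (Fin n) (Fin m) ℝ)
    (R : Matrix (Fin m) (Fin m) ℝ)
    (A0 : Fin r → Matrix (Fin n) (Fin n) ℝ) (B0 : Fin r → Matrix (Fin n) (Fin m) ℝ)
    (X : Matrix (Fin n) (Fin n) ℝ) : Matrix (Fin n) (Fin n) ℝ :=
  Qc Q A0 X - Lc L A0 B0 X * (Rc R B0 X)⁻¹ * (Lc L A0 B0 X)ᵀ

/-- The SCARE residual
`𝓡(X) = AᵀX + XA + Q_c(X) − (XB + L_c(X)) R_c(X)⁻¹ (XB + L_c(X))ᵀ`. -/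
def scareRes {n m r : ℕ} (A : Matrix (Fin n) (Fin n) ℝ) (B : Matrix (Fin n) (Fin m) ℝ)
    (Q : Matrix (Fin n) (Fin n) ℝ) (L : Matrix (Fin n) (Fin m) ℝ)
    (R : Matrix (Fin m) (Fin m) ℝ)
    (A0 : Fin r → Matrix (Fin n) (Fin n) ℝ) (B0 : Fin r → Matrix (Fin n) (Fin m) ℝ)
    (X : Matrix (Fin n) (Fin n) ℝ) : Matrix (Fin n) (Fin n) ℝ :=
  Aᵀ * X + X * A + Qc Q A0 X -
    (X * B + Lc L A0 B0 X) * (Rc R B0 X)⁻¹ * (X * B + Lc L A0 B0 X)ᵀ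

/-- `Ω(X) = [−G_c(X), −A_c(X); −A_c(X)ᵀ, H_c(X)]`. -/
def Omega {n m r : ℕ} (A : Matrix (Fin n) (Fin n) ℝ) (B : Matrix (Fin n) (Fin m) ℝ)
    (Q : Matrix (Fin n) (Fin n) ℝ) (L : Matrix (Fin n) (Fin m) ℝ)
    (R : Matrix (Fin m) (Fin m) ℝ)
    (A0 : Fin r → Matrix (Fin n) (Fin n) ℝ) (B0 : Fin r → Matrix (Fin n) (Fin m) ℝ)
    (X : Matrix (Fin n) (Fin n) ℝ) : Matrix (Fin n ⊕ Fin n) (Fin n ⊕ Fin n) ℝ :=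
  fromBlocks (-(Gc B R B0 X)) (-(Ac A B L R A0 B0 X)) (-(Ac A B L R A0 B0 X))ᵀ
    (Hc Q L R A0 B0 X)

/-- The `2n×n` matrix `[X; −Iₙ]` stacking `X` over `−Iₙ`. -/
def stackNegI {n : ℕ} (X : Matrix (Fin n) (Fin n) ℝ) :
    Matrix (Fin n ⊕ Fin n) (Fin n) ℝ :=
  fromRows X (-1)

/-- The pair `(A, B)` is stabilizable: `yᴴ(A − λI) = 0`, `yᴴB = 0`, `Re λ ≥ 0` imply `y = 0`. -/
def Stabilizable {n m : ℕ} (A : Matrix (Fin n) (Fin n) ℝ)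
    (B : Matrix (Fin n) (Fin m) ℝ) : Prop :=
  ∀ (lam : ℂ) (y : Fin n → ℂ), 0 ≤ lam.re →
    vecMul (star y) (A.map Complex.ofReal - lam • 1) = 0 →
    vecMul (star y) (B.map Complex.ofReal) = 0 → y = 0

/-- The pair `(C, A)` is detectable: `(A − λI)z = 0`, `Cz = 0`, `Re λ ≥ 0` imply `z = 0`. -/
def Detectable {p n : ℕ} (C : Matrix (Fin p) (Fin n) ℝ)
    (A : Matrix (Fin n) (Fin n) ℝ) : Prop :=
  ∀ (lam : ℂ) (z : Fin n → ℂ), 0 ≤ lam.re →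
    mulVec (A.map Complex.ofReal - lam • 1) z = 0 →
    mulVec (C.map Complex.ofReal) z = 0 → z = 0

/-- A real square matrix is stable if all its (complex) eigenvalues have negative real part. -/
def IsStableMatrix {n : ℕ} (M : Matrix (Fin n) (Fin n) ℝ) : Prop :=
  ∀ μ ∈ spectrum ℂ (M.map Complex.ofReal), μ.re < 0

/-- Kernel condition: `(Q − LR⁻¹Lᵀ)z = 0` implies `Lᵀz = 0` and `A₀ⁱ z = 0` for all `i`. -/
def KernelCondition {n m r : ℕ} (Q : Matrix (Fin n) (Fin n) ℝ)
    (L : Matrix (Fin n) (Fin m) ℝ) (R : Matrix (Fin m) (Fin m) ℝ)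
    (A0 : Fin r → Matrix (Fin n) (Fin n) ℝ) : Prop :=
  ∀ z : Fin n → ℂ,
    mulVec ((Q - L * R⁻¹ * Lᵀ).map Complex.ofReal) z = 0 →
    mulVec (Lᵀ.map Complex.ofReal) z = 0 ∧
      ∀ i, mulVec ((A0 i).map Complex.ofReal) z = 0

/-- `Γ(X) = [[0, −A, −B], [−Aᵀ, Q_c(X), L_c(X)], [−Bᵀ, L_c(X)ᵀ, R_c(X)]]`. -/
def Gamma {n m r : ℕ} (A : Matrix (Fin n) (Fin n) ℝ) (B : Matrix (Fin n) (Fin m) ℝ)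
    (Q : Matrix (Fin n) (Fin n) ℝ) (L : Matrix (Fin n) (Fin m) ℝ)
    (R : Matrix (Fin m) (Fin m) ℝ)
    (A0 : Fin r → Matrix (Fin n) (Fin n) ℝ) (B0 : Fin r → Matrix (Fin n) (Fin m) ℝ)
    (X : Matrix (Fin n) (Fin n) ℝ) :
    Matrix ((Fin n ⊕ Fin n) ⊕ Fin m) ((Fin n ⊕ Fin n) ⊕ Fin m) ℝ :=
  fromBlocks (fromBlocks 0 (-A) (-Aᵀ) (Qc Q A0 X))
    (fromRows (-B) (Lc L A0 B0 X))
    (fromRows (-B) (Lc L A0 B0 X))ᵀ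
    (Rc R B0 X)

/-- `F_W(Y) = [Y; −Iₙ]ᵀ (Ω(Y) − Ω(W)) [Y; −Iₙ]`. -/
def FW {n m r : ℕ} (A : Matrix (Fin n) (Fin n) ℝ) (B : Matrix (Fin n) (Fin m) ℝ)
    (Q : Matrix (Fin n) (Fin n) ℝ) (L : Matrix (Fin n) (Fin m) ℝ)
    (R : Matrix (Fin m) (Fin m) ℝ)
    (A0 : Fin r → Matrix (Fin n) (Fin n) ℝ) (B0 : Fin r → Matrix (Fin n) (Fin m) ℝ)
    (W Y : Matrix (Fin n) (Fin n) ℝ) : Matrix (Fin n) (Fin n) ℝ :=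
  (stackNegI Y)ᵀ * (Omega A B Q L R A0 B0 Y - Omega A B Q L R A0 B0 W) * stackNegI Y

/-- `𝓕_W(Z) = Kᵀ Π(Z) K` with `K = [−Iₙ; R_c(W)⁻¹ (L_c(W) + W B)ᵀ]`. -/
def Fcal {n m r : ℕ} (B : Matrix (Fin n) (Fin m) ℝ)
    (L : Matrix (Fin n) (Fin m) ℝ) (R : Matrix (Fin m) (Fin m) ℝ)
    (A0 : Fin r → Matrix (Fin n) (Fin n) ℝ) (B0 : Fin r → Matrix (Fin n) (Fin m) ℝ)
    (W Z : Matrix (Fin n) (Fin n) ℝ) : Matrix (Fin n) (Fin n) ℝ :=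
  (fromRows (-1 : Matrix (Fin n) (Fin n) ℝ)
      ((Rc R B0 W)⁻¹ * (Lc L A0 B0 W + W * B)ᵀ))ᵀ *
    PiBlock A0 B0 Z *
    fromRows (-1 : Matrix (Fin n) (Fin n) ℝ)
      ((Rc R B0 W)⁻¹ * (Lc L A0 B0 W + W * B)ᵀ)

/-- Powers of a complex matrix with spectrum in the open unit disc tend to zero. -/
theorem aux_pow_tendsto {n : ℕ} (hn : 0 < n) (C : Matrix (Fin n) (Fin n) ℂ)
    (h : ∀ (μ : ℂ) (z : Fin n → ℂ), z ≠ 0 → C *ᵥ z = μ • z → ‖μ‖ < 1) (i j : Fin n) :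
    Tendsto (fun k : ℕ => (C ^ k) i j) atTop (nhds 0) := by
  have : Nonempty (Fin n) := ⟨⟨0, hn⟩⟩
  letI : NormedRing (Matrix (Fin n) (Fin n) ℂ) := Matrix.linftyOpNormedRing
  letI : NormedAlgebra ℂ (Matrix (Fin n) (Fin n) ℂ) := Matrix.linftyOpNormedAlgebra
  have hs : spectralRadius ℂ C < (1 : NNReal) := by
    apply spectrum.spectralRadius_lt_of_forall_lt
    intro μ hμ
    rw [← Matrix.spectrum_toLin', ← Module.End.hasEigenvalue_iff_mem_spectrum] at hμ
    obtain ⟨z, hz⟩ := hμ.exists_hasEigenvector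
    have := h μ z hz.2 (by simpa using hz.apply_eq_smul)
    exact_mod_cast this
  obtain ⟨q, hq1, hq2⟩ := ENNReal.lt_iff_exists_nnreal_btwn.1 hs
  have hg := spectrum.pow_nnnorm_pow_one_div_tendsto_nhds_spectralRadius C
  have hev := hg.eventually (gt_mem_nhds hq1)
  have hq2' : q < 1 := by exact_mod_cast hq2
  have hqt : Tendsto (fun k : ℕ => (q : ℝ) ^ k) atTop (nhds 0) :=
    tendsto_pow_atTop_nhds_zero_of_lt_one q.2 (by exact_mod_cast hq2')
  refine squeeze_zero_norm' ?_ hqt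
  filter_upwards [hev, eventually_gt_atTop 0] with k hk hk0
  have h1 : (‖C ^ k‖₊ : ENNReal) ≤ (q : ENNReal) ^ k := by
    have := ENNReal.rpow_le_rpow hk.le (z := (k : ℝ)) (by positivity)
    rw [← ENNReal.rpow_mul, one_div_mul_cancel (by positivity), ENNReal.rpow_one,
      ENNReal.rpow_natCast] at this
    exact this
  have h2 : ‖C ^ k‖₊ ≤ q ^ k := by exact_mod_cast h1
  have h3 : ‖(C ^ k) i j‖₊ ≤ ‖C ^ k‖₊ := by
    rw [Matrix.linfty_opNNNorm_def]
    refine le_trans ?_ (Finset.le_sup (f := fun i => ∑ j, ‖(C ^ k) i j‖₊) (Finset.mem_univ i))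
    exact Finset.single_le_sum (f := fun j => ‖(C ^ k) i j‖₊) (fun _ _ => zero_le) (Finset.mem_univ j)
  exact_mod_cast h3.trans h2

/-- Lyapunov lemma. -/
theorem aux_lyap {n : ℕ} (hn : 0 < n) (M D : Matrix (Fin n) (Fin n) ℝ)
    (hM : ∀ (lam : ℂ) (z : Fin n → ℂ), 0 ≤ lam.re →
      M.map Complex.ofReal *ᵥ z = lam • z → z = 0)
    (hD : D.IsHermitian) (hP : (-(Mᵀ * D + D * M)).PosSemidef) : D.PosSemidef := by
  set Mc := M.map Complex.ofReal with hMc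
  have hdet : IsUnit (M - 1).det := by
    rw [isUnit_iff_ne_zero]
    intro h0
    obtain ⟨v, hv, hv0⟩ := Matrix.exists_mulVec_eq_zero_iff.2 h0
    apply hv
    have : Complex.ofReal ∘ v = 0 := by
      apply hM 1 _ (by simp)
      rw [sub_mulVec, one_mulVec, sub_eq_zero] at hv0
      have := (RingHom.map_mulVec Complex.ofRealHom M v)
      ext i
      have := this i
      rw [hv0] at this
      simp at this
      rw [one_smul]
      exact this.symm
    ext i
    have := congrFun this i
    simpa using this
  set T := (M - 1)⁻¹ with hT
  have hT1 : (M - 1) * T = 1 := Matrix.mul_nonsing_inv _ hdet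
  have hT2 : T * (M - 1) = 1 := Matrix.nonsing_inv_mul _ hdet
  set C := (M + 1) * T with hC
  have hCM : C * (M - 1) = M + 1 := by rw [hC, Matrix.mul_assoc, hT2, Matrix.mul_one]
  have key : D - Cᵀ * D * C = Tᵀ * ((2 : ℝ) • (-(Mᵀ * D + D * M))) * T := by
    have hD' : D = Tᵀ * ((M - 1)ᵀ * D * (M - 1)) * T := by
      calc D = ((M - 1) * T)ᵀ * D * ((M - 1) * T) := by rw [hT1]; simp
        _ = _ := by rw [transpose_mul]; simp only [Matrix.mul_assoc]
    have hC' : Cᵀ * D * C = Tᵀ * ((M + 1)ᵀ * D * (M + 1)) * T := by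
      rw [hC, transpose_mul]; simp only [Matrix.mul_assoc]
    rw [hC']
    nth_rewrite 1 [hD']
    rw [← Matrix.sub_mul, ← Matrix.mul_sub]
    congr 2
    simp only [transpose_sub, transpose_add, transpose_one, two_smul]
    noncomm_ring
  have hstep : (D - Cᵀ * D * C).PosSemidef := by
    rw [key]
    have := (hP.smul (show (0 : ℝ) ≤ 2 by norm_num)).conjTranspose_mul_mul_same T
    simpa [conjTranspose_eq_transpose_of_trivial] using this
  have hpow : ∀ i j, Tendsto (fun k : ℕ => (C ^ k) i j) atTop (nhds 0) := by
    intro i j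
    have hcc := aux_pow_tendsto hn (C.map Complex.ofReal) ?_ i j
    · have e : ∀ k : ℕ, ((C.map Complex.ofReal) ^ k) i j = ((C ^ k) i j : ℂ) := by
        intro k
        have := congrFun (congrFun (map_pow (Complex.ofRealHom.mapMatrix) C k) i) j
        exact this.symm
      simp only [e] at hcc
      have := (Complex.continuous_re.tendsto _).comp hcc
      simpa [Function.comp_def] using this
    · intro μ z hz hmz
      have h1 : C.map Complex.ofReal * (Mc - 1) = Mc + 1 := by
        have := congrArg (Complex.ofRealHom.mapMatrix) hCM
        simp only [map_mul, map_sub, map_add, map_one] at this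
        exact this
      have h2 : (Mc - 1) * T.map Complex.ofReal = 1 := by
        have := congrArg (Complex.ofRealHom.mapMatrix) hT1
        simp only [map_mul, map_sub, map_add, map_one] at this
        exact this
      set y := T.map Complex.ofReal *ᵥ z with hy
      have hzy : (Mc - 1) *ᵥ y = z := by rw [hy, mulVec_mulVec, h2, one_mulVec]
      have hyne : y ≠ 0 := by
        rintro h0
        rw [h0, mulVec_zero] at hzy
        exact hz hzy.symm
      have h3 : (Mc + 1) *ᵥ y = μ • ((Mc - 1) *ᵥ y) := by
        rw [← h1, ← mulVec_mulVec, hzy, hmz]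
      rw [add_mulVec, sub_mulVec, one_mulVec, smul_sub] at h3
      have h4 : (μ - 1) • (Mc *ᵥ y) = (μ + 1) • y := by
        have : (μ - 1) • (Mc *ᵥ y) = μ • (Mc *ᵥ y) - Mc *ᵥ y := by rw [sub_smul, one_smul]
        rw [this, add_smul, one_smul]
        have e : Mc *ᵥ y = μ • Mc *ᵥ y - μ • y - y := by rw [← h3]; simp
        nth_rewrite 2 [e]
        abel
      have hμ1 : μ - 1 ≠ 0 := by
        intro h0
        have : μ = 1 := sub_eq_zero.1 h0
        rw [h0, zero_smul, this] at h4
        have := smul_eq_zero.1 h4.symm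
        rcases this with h | h
        · norm_num at h
        · exact hyne h
      have h5 : Mc *ᵥ y = ((μ + 1) / (μ - 1)) • y := by
        rw [div_eq_inv_mul, mul_smul, ← h4, smul_smul, inv_mul_cancel₀ hμ1, one_smul]
      by_contra hge
      push Not at hge
      apply hyne
      apply hM _ _ _ h5
      rw [Complex.div_re, ← add_div]
      apply div_nonneg _ (Complex.normSq_nonneg _)
      have : 1 ≤ μ.re * μ.re + μ.im * μ.im := by
        rw [← Complex.normSq_apply, Complex.normSq_eq_norm_sq]; nlinarith
      simp
      nlinarith
  have hiter : ∀ k : ℕ, (D - (C ^ k)ᵀ * D * C ^ k).PosSemidef := by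
    intro k
    induction k with
    | zero => simpa using Matrix.PosSemidef.zero
    | succ k ih =>
      have := hstep.add (ih.conjTranspose_mul_mul_same C)
      convert this using 1
      rw [conjTranspose_eq_transpose_of_trivial, pow_succ, transpose_mul]
      noncomm_ring
  refine Matrix.PosSemidef.of_dotProduct_mulVec_nonneg hD fun x => ?_
  have hlim : Tendsto (fun k : ℕ => star x ⬝ᵥ (((C ^ k)ᵀ * D * C ^ k) *ᵥ x)) atTop (nhds 0) := by
    have hCk : Tendsto (fun k : ℕ => C ^ k) atTop (nhds 0) :=
      tendsto_pi_nhds.2 fun i => tendsto_pi_nhds.2 fun j => hpow i j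
    have hc : Continuous (fun E : Matrix (Fin n) (Fin n) ℝ => star x ⬝ᵥ ((Eᵀ * D * E) *ᵥ x)) := by
      fun_prop
    have := (hc.tendsto 0).comp hCk
    simpa [Function.comp_def] using this
  refine le_of_tendsto' hlim fun k => ?_
  have := (hiter k).dotProduct_mulVec_nonneg x
  rw [sub_mulVec, dotProduct_sub] at this
  linarith

open scoped ComplexOrder in
/-- A real positive semidefinite matrix stays so over the complex numbers. -/
theorem aux_psd_map {n : ℕ} {S : Matrix (Fin n) (Fin n) ℝ} (hS : S.PosSemidef) :
    (S.map Complex.ofReal).PosSemidef := by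
  open scoped MatrixOrder in
  obtain ⟨T, rfl⟩ := CStarAlgebra.nonneg_iff_eq_star_mul_self.mp hS.nonneg
  have : (star T * T).map Complex.ofReal = (T.map Complex.ofReal)ᴴ * T.map Complex.ofReal := by
    have h1 : (star T * T).map Complex.ofReal
        = (star T).map Complex.ofReal * T.map Complex.ofReal :=
      Matrix.map_mul (f := Complex.ofRealHom)
    rw [h1]
    congr 1
    ext i j
    simp [star_eq_conjTranspose]
  rw [this]
  exact posSemidef_conjTranspose_mul_self _

theorem aux_cmul {a b c : ℕ} (M : Matrix (Fin a) (Fin b) ℝ) (N : Matrix (Fin b) (Fin c) ℝ) :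
    (M * N).map Complex.ofReal = M.map Complex.ofReal * N.map Complex.ofReal :=
  Matrix.map_mul (f := Complex.ofRealHom)

theorem aux_cadd {a b : ℕ} (M N : Matrix (Fin a) (Fin b) ℝ) :
    (M + N).map Complex.ofReal = M.map Complex.ofReal + N.map Complex.ofReal := by
  ext i j; simp

theorem aux_csub {a b : ℕ} (M N : Matrix (Fin a) (Fin b) ℝ) :
    (M - N).map Complex.ofReal = M.map Complex.ofReal - N.map Complex.ofReal := by
  ext i j; simp

open scoped ComplexOrder in
/-- Sum of two psd matrices annihilated in quadratic form. -/
theorem aux_psd_add_zero {n : ℕ} {S T : Matrix (Fin n) (Fin n) ℝ} (hS : S.PosSemidef)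
    (hT : T.PosSemidef) (z : Fin n → ℂ)
    (h : star z ⬝ᵥ ((S + T).map Complex.ofReal *ᵥ z) = 0) :
    S.map Complex.ofReal *ᵥ z = 0 ∧ T.map Complex.ofReal *ᵥ z = 0 := by
  have h1 := (aux_psd_map hS).dotProduct_mulVec_nonneg z
  have h2 := (aux_psd_map hT).dotProduct_mulVec_nonneg z
  rw [aux_cadd, add_mulVec, dotProduct_add] at h
  have := (add_eq_zero_iff_of_nonneg h1 h2).1 h
  exact ⟨((aux_psd_map hS).dotProduct_mulVec_zero_iff z).1 this.1,
    ((aux_psd_map hT).dotProduct_mulVec_zero_iff z).1 this.2⟩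

theorem aux_congr_psd {a b : ℕ} {S : Matrix (Fin a) (Fin a) ℝ} (hS : S.PosSemidef)
    (M : Matrix (Fin a) (Fin b) ℝ) : (Mᵀ * S * M).PosSemidef := by
  have := hS.conjTranspose_mul_mul_same M
  rwa [conjTranspose_eq_transpose_of_trivial] at this

theorem aux_Pi22_psd {n m r : ℕ} (B0 : Fin r → Matrix (Fin n) (Fin m) ℝ)
    {X : Matrix (Fin n) (Fin n) ℝ} (hX : X.PosSemidef) : (Pi22 B0 X).PosSemidef :=
  posSemidef_sum _ fun i _ => aux_congr_psd hX (B0 i)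

theorem aux_Rc_pd {n m r : ℕ} {R : Matrix (Fin m) (Fin m) ℝ}
    (B0 : Fin r → Matrix (Fin n) (Fin m) ℝ) (hR : R.PosDef)
    {X : Matrix (Fin n) (Fin n) ℝ} (hX : X.PosSemidef) : (Rc R B0 X).PosDef :=
  hR.add_posSemidef (aux_Pi22_psd B0 hX)

theorem aux_symm {n : ℕ} {M : Matrix (Fin n) (Fin n) ℝ} (h : M.IsHermitian) : Mᵀ = M := by
  have := h.eq
  rwa [conjTranspose_eq_transpose_of_trivial] at this

/-- `G_c(X) ⪯ B R⁻¹ Bᵀ`, conjugated. -/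
theorem aux_inv_le {n m r : ℕ} {R : Matrix (Fin m) (Fin m) ℝ}
    (B0 : Fin r → Matrix (Fin n) (Fin m) ℝ) (hR : R.PosDef)
    {X : Matrix (Fin n) (Fin n) ℝ} (hX : X.PosSemidef) : (R⁻¹ - (Rc R B0 X)⁻¹).PosSemidef := by
  have hN := aux_Pi22_psd B0 hX
  have hRc := aux_Rc_pd B0 hR hX
  set N := Pi22 B0 X
  have hRcN : Rc R B0 X = R + N := rfl
  set S := Rc R B0 X
  have u1 := (Matrix.isUnit_iff_isUnit_det _).1 hR.isUnit
  have u2 := (Matrix.isUnit_iff_isUnit_det _).1 hRc.isUnit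
  have hSs : (S⁻¹)ᵀ = S⁻¹ := aux_symm hRc.inv.isHermitian
  have hNs : Nᵀ = N := aux_symm hN.isHermitian
  have e1 : R⁻¹ = S⁻¹ + S⁻¹ * N * R⁻¹ := by
    have : S⁻¹ * S * R⁻¹ = R⁻¹ := by rw [nonsing_inv_mul _ u2, Matrix.one_mul]
    rw [← this]
    nth_rewrite 2 [hRcN]
    rw [Matrix.mul_add, Matrix.add_mul, Matrix.mul_assoc, mul_nonsing_inv _ u1, Matrix.mul_one,
      this]
  have e2 : R⁻¹ = S⁻¹ + R⁻¹ * N * S⁻¹ := by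
    have := congrArg transpose e1
    have hRs : (R⁻¹)ᵀ = R⁻¹ := aux_symm hR.inv.isHermitian
    simpa only [transpose_add, transpose_mul, hRs, hSs, hNs, Matrix.mul_assoc] using this
  have e : R⁻¹ - S⁻¹ = (S⁻¹)ᵀ * N * S⁻¹ + (N * S⁻¹)ᵀ * R⁻¹ * (N * S⁻¹) := by
    rw [transpose_mul, hSs, hNs]
    calc R⁻¹ - S⁻¹ = S⁻¹ * N * R⁻¹ := by nth_rewrite 1 [e1]; abel
      _ = S⁻¹ * N * (S⁻¹ + R⁻¹ * N * S⁻¹) := by rw [← e2]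
      _ = _ := by simp only [Matrix.mul_add, Matrix.mul_assoc]
  rw [e]
  exact (aux_congr_psd hN _).add (aux_congr_psd hR.inv.posSemidef _)

/-- `H_c(X) = (Q − L R⁻¹ Lᵀ) + psd`. -/
theorem aux_Hc_ge {n m r : ℕ} (Q : Matrix (Fin n) (Fin n) ℝ) (L : Matrix (Fin n) (Fin m) ℝ)
    {R : Matrix (Fin m) (Fin m) ℝ}
    (A0 : Fin r → Matrix (Fin n) (Fin n) ℝ) (B0 : Fin r → Matrix (Fin n) (Fin m) ℝ)
    (hR : R.PosDef) {X : Matrix (Fin n) (Fin n) ℝ} (hX : X.PosSemidef) :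
    (Hc Q L R A0 B0 X - (Q - L * R⁻¹ * Lᵀ)).PosSemidef := by
  have hRc := aux_Rc_pd B0 hR hX
  have u1 := (Matrix.isUnit_iff_isUnit_det _).1 hR.isUnit
  have u2 := (Matrix.isUnit_iff_isUnit_det _).1 hRc.isUnit
  have hSs : ((Rc R B0 X)⁻¹)ᵀ = (Rc R B0 X)⁻¹ := aux_symm hRc.inv.isHermitian
  have hRis : (R⁻¹)ᵀ = R⁻¹ := aux_symm hR.inv.isHermitian
  have hRs : Rᵀ = R := aux_symm hR.isHermitian
  have hXs : Xᵀ = X := aux_symm hX.isHermitian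
  set K := (Rc R B0 X)⁻¹ * (Lc L A0 B0 X)ᵀ with hK
  have hRK : Rc R B0 X * K = (Lc L A0 B0 X)ᵀ := by
    rw [hK, ← Matrix.mul_assoc, mul_nonsing_inv _ u2, Matrix.one_mul]
  have hKR : Kᵀ * Rc R B0 X = Lc L A0 B0 X := by
    have := congrArg transpose hRK
    rwa [transpose_mul, transpose_transpose, aux_symm hRc.isHermitian] at this
  have hsum : ∑ i, (A0 i - B0 i * K)ᵀ * X * (A0 i - B0 i * K) =
      Pi11 A0 X - Pi12 A0 B0 X * K - Kᵀ * (Pi12 A0 B0 X)ᵀ + Kᵀ * Pi22 B0 X * K := by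
    simp only [Pi11, Pi12, Pi22, transpose_sum, Matrix.sum_mul, Matrix.mul_sum,
      ← Finset.sum_sub_distrib, ← Finset.sum_add_distrib]
    refine Finset.sum_congr rfl fun i _ => ?_
    simp only [transpose_sub, transpose_mul, transpose_transpose, Matrix.sub_mul, Matrix.mul_sub,
      Matrix.mul_assoc, hXs]
    abel
  have e : Hc Q L R A0 B0 X - (Q - L * R⁻¹ * Lᵀ) =
      (K - R⁻¹ * Lᵀ)ᵀ * R * (K - R⁻¹ * Lᵀ) +
        ∑ i, (A0 i - B0 i * K)ᵀ * X * (A0 i - B0 i * K) := by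
    rw [hsum]
    have h1 : (K - R⁻¹ * Lᵀ)ᵀ * R * (K - R⁻¹ * Lᵀ) =
        Kᵀ * R * K - L * K - Kᵀ * Lᵀ + L * R⁻¹ * Lᵀ := by
      rw [transpose_sub, transpose_mul R⁻¹ Lᵀ, transpose_transpose, hRis]
      have a1 : (Kᵀ - L * R⁻¹) * R = Kᵀ * R - L := by
        rw [Matrix.sub_mul, Matrix.mul_assoc L, nonsing_inv_mul _ u1, Matrix.mul_one]
      have a2 : Kᵀ * R * (R⁻¹ * Lᵀ) = Kᵀ * Lᵀ := by
        rw [Matrix.mul_assoc, ← Matrix.mul_assoc R, mul_nonsing_inv _ u1, Matrix.one_mul]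
      rw [a1, Matrix.mul_sub, Matrix.sub_mul, Matrix.sub_mul, a2]
      simp only [Matrix.mul_assoc]
      abel
    rw [h1]
    have h2 : Kᵀ * R * K + Kᵀ * Pi22 B0 X * K = Lc L A0 B0 X * K := by
      rw [← Matrix.add_mul, ← Matrix.mul_add]
      change Kᵀ * Rc R B0 X * K = _
      rw [hKR]
    have h3 : L * K + Pi12 A0 B0 X * K = Lc L A0 B0 X * K := by
      rw [← Matrix.add_mul]; rfl
    have h4 : Kᵀ * Lᵀ + Kᵀ * (Pi12 A0 B0 X)ᵀ = Lc L A0 B0 X * K := by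
      rw [← Matrix.mul_add, ← transpose_add]
      change Kᵀ * (Lc L A0 B0 X)ᵀ = _
      rw [← hRK, ← Matrix.mul_assoc, hKR]
    have h5 : Hc Q L R A0 B0 X = Q + Pi11 A0 X - Lc L A0 B0 X * K := by
      rw [Hc, Qc, hK, Matrix.mul_assoc]
    rw [h5]
    have h6 : Lc L A0 B0 X * K = (L * K + Pi12 A0 B0 X * K) + (Kᵀ * Lᵀ + Kᵀ * (Pi12 A0 B0 X)ᵀ)
       - (Kᵀ * R * K + Kᵀ * Pi22 B0 X * K) := by rw [h2, h3, h4]; abel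
    rw [h6]
    abel
  rw [e]
  exact (aux_congr_psd hR.posSemidef _).add
    (posSemidef_sum _ fun i _ => aux_congr_psd hX _)

theorem aux_res_eq {n m r : ℕ} (A : Matrix (Fin n) (Fin n) ℝ) (B : Matrix (Fin n) (Fin m) ℝ)
    (Q : Matrix (Fin n) (Fin n) ℝ) (L : Matrix (Fin n) (Fin m) ℝ)
    {R : Matrix (Fin m) (Fin m) ℝ}
    (A0 : Fin r → Matrix (Fin n) (Fin n) ℝ) (B0 : Fin r → Matrix (Fin n) (Fin m) ℝ)
    (hR : R.PosDef) {X : Matrix (Fin n) (Fin n) ℝ} (hX : X.PosSemidef) :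
    scareRes A B Q L R A0 B0 X = (Ac A B L R A0 B0 X)ᵀ * X + X * Ac A B L R A0 B0 X
      - X * Gc B R B0 X * X + Hc Q L R A0 B0 X := by
  have hRc := aux_Rc_pd B0 hR hX
  have hSs : ((Rc R B0 X)⁻¹)ᵀ = (Rc R B0 X)⁻¹ := aux_symm hRc.inv.isHermitian
  have hXs : Xᵀ = X := aux_symm hX.isHermitian
  simp only [scareRes, Ac, Gc, Hc, transpose_sub, transpose_add, transpose_mul,
    transpose_transpose, hSs, hXs, Matrix.mul_add, Matrix.add_mul, Matrix.mul_sub, Matrix.sub_mul,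
    Matrix.mul_assoc]
  abel

theorem aux_FW_eq {n m r : ℕ} (A : Matrix (Fin n) (Fin n) ℝ) (B : Matrix (Fin n) (Fin m) ℝ)
    (Q : Matrix (Fin n) (Fin n) ℝ) (L : Matrix (Fin n) (Fin m) ℝ)
    {R : Matrix (Fin m) (Fin m) ℝ}
    (A0 : Fin r → Matrix (Fin n) (Fin n) ℝ) (B0 : Fin r → Matrix (Fin n) (Fin m) ℝ)
    (hR : R.PosDef) {Y : Matrix (Fin n) (Fin n) ℝ} (hY : Y.PosSemidef)
    (W : Matrix (Fin n) (Fin n) ℝ) :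
    FW A B Q L R A0 B0 W Y = scareRes A B Q L R A0 B0 Y -
      ((Ac A B L R A0 B0 W)ᵀ * Y + Y * Ac A B L R A0 B0 W
      - Y * Gc B R B0 W * Y + Hc Q L R A0 B0 W) := by
  have hYs : Yᵀ = Y := aux_symm hY.isHermitian
  rw [aux_res_eq A B Q L A0 B0 hR hY]
  simp only [FW, stackNegI, Omega, Matrix.mul_sub, Matrix.sub_mul, transpose_fromRows, hYs,
    Matrix.fromCols_mul_fromBlocks, Matrix.fromCols_mul_fromRows]
  simp only [transpose_neg, transpose_one, Matrix.mul_add, Matrix.add_mul, Matrix.mul_neg,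
    Matrix.neg_mul, Matrix.mul_one, Matrix.one_mul, neg_neg]
  abel

open scoped ComplexOrder in
/-- Every closed-loop matrix `A_c(X) − G_c(X) X` is stable as soon as the Lyapunov equation has a
positive semidefinite solution. -/
theorem aux_stable {n m r : ℕ}
    (A Q : Matrix (Fin n) (Fin n) ℝ) (B L : Matrix (Fin n) (Fin m) ℝ)
    (R : Matrix (Fin m) (Fin m) ℝ)
    (A0 : Fin r → Matrix (Fin n) (Fin n) ℝ) (B0 : Fin r → Matrix (Fin n) (Fin m) ℝ)
    (hR : R.PosDef) (hQL : (Q - L * R⁻¹ * Lᵀ).PosSemidef)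
    (hker : KernelCondition Q L R A0)
    (hdet : Detectable (Q - L * R⁻¹ * Lᵀ) A)
    {X Y : Matrix (Fin n) (Fin n) ℝ} (hX : X.PosSemidef) (hY : Y.PosSemidef)
    (hly : (Ac A B L R A0 B0 X - Gc B R B0 X * X)ᵀ * Y +
      Y * (Ac A B L R A0 B0 X - Gc B R B0 X * X) +
      (X * Gc B R B0 X * X + Hc Q L R A0 B0 X) = 0)
    (lam : ℂ) (z : Fin n → ℂ) (hlam : 0 ≤ lam.re)
    (hz : (Ac A B L R A0 B0 X - Gc B R B0 X * X).map Complex.ofReal *ᵥ z = lam • z) : z = 0 := by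
  have hRc := aux_Rc_pd B0 hR hX
  have hXs : Xᵀ = X := aux_symm hX.isHermitian
  have hXGX : X * Gc B R B0 X * X = (Bᵀ * X)ᵀ * (Rc R B0 X)⁻¹ * (Bᵀ * X) := by
    simp only [Gc, transpose_mul, transpose_transpose, hXs, Matrix.mul_assoc]
  have p1 : (X * Gc B R B0 X * X).PosSemidef := by
    rw [hXGX]; exact aux_congr_psd hRc.inv.posSemidef _
  have p2 := aux_Hc_ge Q L A0 B0 hR hX
  have p3 : (Hc Q L R A0 B0 X).PosSemidef := by
    have := p2.add hQL
    rwa [sub_add_cancel] at this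
  set M := Ac A B L R A0 B0 X - Gc B R B0 X * X with hM
  set S := X * Gc B R B0 X * X + Hc Q L R A0 B0 X with hS
  have hq : star z ⬝ᵥ (S.map Complex.ofReal *ᵥ z) = 0 := by
    have h1 := congrArg (fun E => star z ⬝ᵥ (E.map Complex.ofReal *ᵥ z)) hly
    have hMt : (Mᵀ).map Complex.ofReal = (M.map Complex.ofReal)ᴴ := by ext i j; simp
    simp only [aux_cadd, aux_cmul, add_mulVec, dotProduct_add, ← mulVec_mulVec, hz, hMt] at h1
    rw [dotProduct_mulVec (star z) ((M.map Complex.ofReal)ᴴ), vecMul_conjTranspose, star_star, hz,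
      mulVec_smul, dotProduct_smul, star_smul, smul_dotProduct] at h1
    have hy0 := (aux_psd_map hY).dotProduct_mulVec_nonneg z
    have hs0 := (aux_psd_map (p1.add p3)).dotProduct_mulVec_nonneg z
    rw [← hS] at hs0
    rw [Complex.le_def] at hy0 hs0
    set a := star z ⬝ᵥ (Y.map Complex.ofReal *ᵥ z)
    set b := star z ⬝ᵥ (S.map Complex.ofReal *ᵥ z)
    have h1r := congrArg Complex.re h1
    have hzero : (0 : Matrix (Fin n) (Fin n) ℝ).map Complex.ofReal = 0 := by ext i j; simp
    have h6 := hy0.2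
    simp [hzero] at h1r h6
    have ha := hy0.1
    have hb := hs0.1
    simp at ha hb
    apply Complex.ext
    · simp
      nlinarith [mul_nonneg hlam ha]
    · exact hs0.2.symm
  obtain ⟨k1, k2⟩ := aux_psd_add_zero p1 p3 z hq
  have k3 : (Bᵀ * X).map Complex.ofReal *ᵥ z = 0 := by
    set w := (Bᵀ * X).map Complex.ofReal *ᵥ z with hw
    have hw0 : star w ⬝ᵥ (((Rc R B0 X)⁻¹).map Complex.ofReal *ᵥ w) = 0 := by
      have h2 : star z ⬝ᵥ ((X * Gc B R B0 X * X).map Complex.ofReal *ᵥ z) = 0 := by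
        rw [k1, dotProduct_zero]
      have ht : ((Bᵀ * X)ᵀ).map Complex.ofReal = ((Bᵀ * X).map Complex.ofReal)ᴴ := by
        ext i j; simp only [map_apply, transpose_apply, conjTranspose_apply]; simp
      rw [hXGX, aux_cmul, aux_cmul, ht, ← mulVec_mulVec, ← mulVec_mulVec, dotProduct_mulVec,
        vecMul_conjTranspose, star_star] at h2
      exact h2
    have hw1 := ((aux_psd_map hRc.inv.posSemidef).dotProduct_mulVec_zero_iff w).1 hw0
    have u2 := (Matrix.isUnit_iff_isUnit_det _).1 hRc.isUnit
    have h3 : (Rc R B0 X).map Complex.ofReal * ((Rc R B0 X)⁻¹).map Complex.ofReal = 1 := by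
      rw [← aux_cmul, mul_nonsing_inv _ u2]
      ext i j; by_cases h : i = j <;> simp [h, Matrix.one_apply]
    have := congrArg (fun v => (Rc R B0 X).map Complex.ofReal *ᵥ v) hw1
    simpa only [mulVec_mulVec, h3, one_mulVec, mulVec_zero] using this
  have k4 : (Q - L * R⁻¹ * Lᵀ).map Complex.ofReal *ᵥ z = 0 := by
    refine (aux_psd_add_zero p2 hQL z ?_).2
    rw [sub_add_cancel, k2, dotProduct_zero]
  obtain ⟨k5, k6⟩ := hker z k4
  have k7 : ((Lc L A0 B0 X)ᵀ).map Complex.ofReal *ᵥ z = 0 := by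
    have hPt : (Pi12 A0 B0 X)ᵀ = ∑ i, (B0 i)ᵀ * X * A0 i := by
      simp only [Pi12, transpose_sum, transpose_mul, transpose_transpose, hXs, Matrix.mul_assoc]
    have hs : (∑ i, (B0 i)ᵀ * X * A0 i).map Complex.ofReal =
        ∑ i, ((B0 i)ᵀ * X * A0 i).map Complex.ofReal := by
      ext a b; simp [Matrix.sum_apply]
    rw [Lc, transpose_add, aux_cadd, add_mulVec, k5, zero_add, hPt, hs, Matrix.sum_mulVec]
    refine Finset.sum_eq_zero fun i _ => ?_
    rw [aux_cmul, ← mulVec_mulVec, k6 i, mulVec_zero]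
  refine hdet lam z hlam ?_ k4
  have hA : A = M + B * (Rc R B0 X)⁻¹ * (Lc L A0 B0 X)ᵀ + B * (Rc R B0 X)⁻¹ * (Bᵀ * X) := by
    rw [hM, Ac, Gc]; simp only [Matrix.mul_assoc]; abel
  have hAz : A.map Complex.ofReal *ᵥ z = lam • z := by
    rw [hA, aux_cadd, aux_cadd, add_mulVec, add_mulVec, aux_cmul _ (Lc L A0 B0 X)ᵀ,
      aux_cmul _ (Bᵀ * X), ← mulVec_mulVec, ← mulVec_mulVec, k7, k3, hz]
    simp
  rw [sub_mulVec, hAz, smul_mulVec, one_mulVec, sub_self]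

/-- Monotone bounded sequences of symmetric matrices converge. -/
theorem aux_mono_conv {n : ℕ} (X : ℕ → Matrix (Fin n) (Fin n) ℝ) (U : Matrix (Fin n) (Fin n) ℝ)
    (hs : ∀ k, (X k).IsHermitian) (hmono : ∀ k, (X (k + 1) - X k).PosSemidef)
    (hb : ∀ k, (U - X k).PosSemidef) :
    ∃ Z, Tendsto X atTop (nhds Z) := by
  have hq : ∀ x : Fin n → ℝ, ∃ l, Tendsto (fun k => x ⬝ᵥ (X k *ᵥ x)) atTop (nhds l) := by
    intro x
    refine ⟨_, tendsto_atTop_ciSup (monotone_nat_of_le_succ fun k => ?_)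
      ⟨x ⬝ᵥ (U *ᵥ x), ?_⟩⟩
    · have := (hmono k).dotProduct_mulVec_nonneg x
      rw [sub_mulVec, dotProduct_sub, star_trivial] at this
      linarith
    · rintro _ ⟨k, rfl⟩
      have := (hb k).dotProduct_mulVec_nonneg x
      rw [sub_mulVec, dotProduct_sub, star_trivial] at this
      simpa using this
  choose l hl using hq
  have hent : ∀ i j k, X k i j = ((Pi.single i 1 + Pi.single j 1 : Fin n → ℝ) ⬝ᵥ
      (X k *ᵥ (Pi.single i 1 + Pi.single j 1)) - (Pi.single i 1 : Fin n → ℝ) ⬝ᵥ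
      (X k *ᵥ Pi.single i 1) - (Pi.single j 1 : Fin n → ℝ) ⬝ᵥ (X k *ᵥ Pi.single j 1)) / 2 := by
    intro i j k
    have : X k j i = X k i j := by
      have := congrFun (congrFun (aux_symm (hs k)) i) j
      exact this
    simp [mulVec_add, this]
    ring
  refine ⟨fun i j => (l (Pi.single i 1 + Pi.single j 1) - l (Pi.single i 1)
    - l (Pi.single j 1)) / 2, tendsto_pi_nhds.2 fun i => tendsto_pi_nhds.2 fun j => ?_⟩
  simp only [hent i j]
  exact (((hl _).sub (hl _)).sub (hl _)).div_const 2

theorem aux_psd_lim {n : ℕ} {X : ℕ → Matrix (Fin n) (Fin n) ℝ} {Z : Matrix (Fin n) (Fin n) ℝ}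
    (hX : ∀ k, (X k).PosSemidef) (h : Tendsto X atTop (nhds Z)) : Z.PosSemidef := by
  refine Matrix.PosSemidef.of_dotProduct_mulVec_nonneg ?_ fun x => ?_
  · have h1 : Tendsto (fun k => (X k)ᴴ) atTop (nhds Zᴴ) :=
      ((continuous_id.matrix_conjTranspose).tendsto Z).comp h
    simp only [fun k => (hX k).isHermitian.eq] at h1
    exact tendsto_nhds_unique h1 h
  · have hc : Continuous (fun E : Matrix (Fin n) (Fin n) ℝ => star x ⬝ᵥ (E *ᵥ x)) := by fun_prop
    exact ge_of_tendsto' ((hc.tendsto Z).comp h) fun k => (hX k).dotProduct_mulVec_nonneg x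

/-- Monotone increasing convergence of the modified Newton iteration. -/
theorem stmt18 (n m r : ℕ) (hn : 0 < n) (hm : 0 < m) (hr : 0 < r)
    (A Q : Matrix (Fin n) (Fin n) ℝ) (B L : Matrix (Fin n) (Fin m) ℝ)
    (R : Matrix (Fin m) (Fin m) ℝ)
    (A0 : Fin r → Matrix (Fin n) (Fin n) ℝ) (B0 : Fin r → Matrix (Fin n) (Fin m) ℝ)
    (hQ : Q.IsHermitian) (hRsymm : R.IsHermitian)
    (hRpd : R.PosDef) (hsign : (fromBlocks Q L Lᵀ R).PosSemidef)
    (hker : KernelCondition Q L R A0)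
    (hstab : Stabilizable A B)
    (hdet : Detectable (Q - L * R⁻¹ * Lᵀ) A)
    (Xs : Matrix (Fin n) (Fin n) ℝ) (hXs : Xs.PosSemidef)
    (hsol : scareRes A B Q L R A0 B0 Xs = 0)
    (huniq : ∀ Y : Matrix (Fin n) (Fin n) ℝ, Y.PosSemidef →
      scareRes A B Q L R A0 B0 Y = 0 → Y = Xs)
    (α : ℝ) (hα : 0 < α)
    (hcoer : ∀ Z : Matrix (Fin n) (Fin n) ℝ, Z.PosSemidef →
      (Fcal B L R A0 B0 Xs Z - α • Z).PosSemidef)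
    (X : ℕ → Matrix (Fin n) (Fin n) ℝ)
    (hsymm : ∀ k, (X k).IsHermitian)
    (h0psd : (X 0).PosSemidef) (h0le : (Xs - X 0).PosSemidef)
    (h0res : (scareRes A B Q L R A0 B0 (X 0)).PosSemidef)
    (hFW : ∀ W Y : Matrix (Fin n) (Fin n) ℝ, W.IsHermitian → Y.IsHermitian →
      (W - X 0).PosSemidef → (Y - W).PosSemidef → (Xs - Y).PosSemidef →
      (FW A B Q L R A0 B0 W Y - (Y - W) * B * R⁻¹ * Bᵀ * (Y - W)).PosSemidef)
    (hiter : ∀ k, (Ac A B L R A0 B0 (X k))ᵀ * X (k+1) +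
        X (k+1) * Ac A B L R A0 B0 (X k) -
        X (k+1) * Gc B R B0 (X k) * X (k+1) + Hc Q L R A0 B0 (X k) +
        (X (k+1) - X k) * Gc B R B0 (X k) * (X (k+1) - X k) = 0)
    (hpsd : ∀ k, (X k).PosSemidef) :
    (∀ k, (X (k+1) - X k).PosSemidef ∧ (Xs - X (k+1)).PosSemidef ∧
        (scareRes A B Q L R A0 B0 (X k)).PosSemidef) ∧
      Tendsto X atTop (nhds Xs) := by
  have hQL : (Q - L * R⁻¹ * Lᵀ).PosSemidef := by
    have hLt : Lᵀ = Lᴴ := (conjTranspose_eq_transpose_of_trivial L).symm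
    rw [hLt] at hsign ⊢
    have : Invertible R := hRpd.isUnit.invertible
    exact (Matrix.PosDef.fromBlocks₂₂ Q L hRpd).1 hsign
  have hGs : ∀ k, (Gc B R B0 (X k))ᵀ = Gc B R B0 (X k) := by
    intro k
    have hSs : ((Rc R B0 (X k))⁻¹)ᵀ = (Rc R B0 (X k))⁻¹ :=
      aux_symm (aux_Rc_pd B0 hRpd (hpsd k)).inv.isHermitian
    simp only [Gc, transpose_mul, transpose_transpose, hSs, Matrix.mul_assoc]
  have hXt : ∀ k, (X k)ᵀ = X k := fun k => aux_symm (hsymm k)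
  set M : ℕ → Matrix (Fin n) (Fin n) ℝ :=
    fun k => Ac A B L R A0 B0 (X k) - Gc B R B0 (X k) * X k with hM
  -- the frozen Riccati operator rewritten around the closed-loop matrix
  have hexp : ∀ k (Y : Matrix (Fin n) (Fin n) ℝ),
      (Ac A B L R A0 B0 (X k))ᵀ * Y + Y * Ac A B L R A0 B0 (X k) - Y * Gc B R B0 (X k) * Y
        + Hc Q L R A0 B0 (X k) + (Y - X k) * Gc B R B0 (X k) * (Y - X k) =
      (M k)ᵀ * Y + Y * M k + (X k * Gc B R B0 (X k) * X k + Hc Q L R A0 B0 (X k)) := by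
    intro k Y
    simp only [hM, transpose_sub, transpose_mul, hGs, hXt]
    noncomm_ring
  have hly : ∀ k, (M k)ᵀ * X (k+1) + X (k+1) * M k +
      (X k * Gc B R B0 (X k) * X k + Hc Q L R A0 B0 (X k)) = 0 := by
    intro k
    rw [← hexp, hiter]
  have hstable : ∀ k (D : Matrix (Fin n) (Fin n) ℝ), D.IsHermitian →
      (-((M k)ᵀ * D + D * M k)).PosSemidef → D.PosSemidef := by
    intro k D hD hP
    exact aux_lyap hn (M k) D (aux_stable A Q B L R A0 B0 hRpd hQL hker hdet (hpsd k)
      (hpsd (k+1)) (hly k)) hD hP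
  -- Lyapunov identity for differences
  have hdiff : ∀ k (Y : Matrix (Fin n) (Fin n) ℝ),
      (M k)ᵀ * (Y - X (k+1)) + (Y - X (k+1)) * M k =
      (Ac A B L R A0 B0 (X k))ᵀ * Y + Y * Ac A B L R A0 B0 (X k) - Y * Gc B R B0 (X k) * Y
        + Hc Q L R A0 B0 (X k) + (Y - X k) * Gc B R B0 (X k) * (Y - X k) := by
    intro k Y
    rw [hexp, ← sub_zero ((M k)ᵀ * Y + Y * M k + _), ← hly k]
    noncomm_ring
  have hresk : ∀ k, (M k)ᵀ * (X (k+1) - X k) + (X (k+1) - X k) * M k =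
      -scareRes A B Q L R A0 B0 (X k) := by
    intro k
    have h1 := hdiff k (X k)
    rw [sub_self, Matrix.zero_mul, Matrix.zero_mul, add_zero,
      ← aux_res_eq A B Q L A0 B0 hRpd (hpsd k)] at h1
    rw [← h1, ← neg_sub (X (k+1)) (X k), Matrix.mul_neg, Matrix.neg_mul, neg_add, neg_neg,
      neg_neg]
  -- comparison of the quadratic terms
  have hcmp : ∀ k (Y : Matrix (Fin n) (Fin n) ℝ), Y.IsHermitian →
      ((Y - X k) * B * R⁻¹ * Bᵀ * (Y - X k) -
        (Y - X k) * Gc B R B0 (X k) * (Y - X k)).PosSemidef := by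
    intro k Y hY
    have h1 := aux_congr_psd (aux_inv_le B0 hRpd (hpsd k)) (Bᵀ * (Y - X k))
    have e : (Y - X k)ᵀ = Y - X k := by rw [transpose_sub, aux_symm hY, hXt]
    rw [transpose_mul, transpose_transpose, e] at h1
    convert h1 using 1
    simp only [Gc, Matrix.mul_sub, Matrix.sub_mul, Matrix.mul_assoc]
    abel
  have hind : ∀ k, (X k - X 0).PosSemidef ∧ (Xs - X k).PosSemidef ∧
      (scareRes A B Q L R A0 B0 (X k)).PosSemidef → (X (k+1) - X k).PosSemidef ∧
      (Xs - X (k+1)).PosSemidef ∧ (scareRes A B Q L R A0 B0 (X (k+1))).PosSemidef := by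
    rintro k ⟨h0, hle, hres⟩
    have s1 : (X (k+1) - X k).PosSemidef := by
      apply hstable k _ ((hsymm _).sub (hsymm _))
      rw [hresk, neg_neg]
      exact hres
    have s2 : (Xs - X (k+1)).PosSemidef := by
      apply hstable k _ (hXs.isHermitian.sub (hsymm _))
      rw [hdiff]
      have h1 := hFW (X k) Xs (hsymm k) hXs.isHermitian h0 hle (by simpa using PosSemidef.zero)
      have h2 := h1.add (hcmp k Xs hXs.isHermitian)
      rw [aux_FW_eq A B Q L A0 B0 hRpd hXs, hsol] at h2
      convert h2 using 1
      abel
    refine ⟨s1, s2, ?_⟩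
    have h1 := hFW (X k) (X (k+1)) (hsymm k) (hsymm _) h0 s1 s2
    have h2 := h1.add (hcmp k (X (k+1)) (hsymm _))
    rw [aux_FW_eq A B Q L A0 B0 hRpd (hpsd _)] at h2
    have h3 := hiter k
    rw [← eq_neg_iff_add_eq_zero] at h3
    rw [h3] at h2
    convert h2 using 1
    abel
  have hall : ∀ k, (X k - X 0).PosSemidef ∧ (Xs - X k).PosSemidef ∧
      (scareRes A B Q L R A0 B0 (X k)).PosSemidef := by
    intro k
    induction k with
    | zero => exact ⟨by simpa using PosSemidef.zero, h0le, h0res⟩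
    | succ k ih =>
      obtain ⟨a, b, c⟩ := hind k ih
      refine ⟨?_, b, c⟩
      have := a.add ih.1
      rwa [sub_add_sub_cancel] at this
  refine ⟨fun k => ⟨(hind k (hall k)).1, (hind k (hall k)).2.1, (hall k).2.2⟩, ?_⟩
  obtain ⟨Z, hZ⟩ := aux_mono_conv X Xs hsymm (fun k => (hind k (hall k)).1) (fun k => (hall k).2.1)
  have hZpsd : Z.PosSemidef := aux_psd_lim hpsd hZ
  have hRcZ := aux_Rc_pd B0 hRpd hZpsd
  have hRt : Tendsto (fun k => Rc R B0 (X k)) atTop (nhds (Rc R B0 Z)) := by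
    have hc : Continuous (fun E : Matrix (Fin n) (Fin n) ℝ => Rc R B0 E) := by
      unfold Rc Pi22; fun_prop
    exact (hc.tendsto Z).comp hZ
  have hLt : Tendsto (fun k => Lc L A0 B0 (X k)) atTop (nhds (Lc L A0 B0 Z)) := by
    have hc : Continuous (fun E : Matrix (Fin n) (Fin n) ℝ => Lc L A0 B0 E) := by
      unfold Lc Pi12; fun_prop
    exact (hc.tendsto Z).comp hZ
  have hQt : Tendsto (fun k => Qc Q A0 (X k)) atTop (nhds (Qc Q A0 Z)) := by
    have hc : Continuous (fun E : Matrix (Fin n) (Fin n) ℝ => Qc Q A0 E) := by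
      unfold Qc Pi11; fun_prop
    exact (hc.tendsto Z).comp hZ
  have hRit : Tendsto (fun k => (Rc R B0 (X k))⁻¹) atTop (nhds (Rc R B0 Z)⁻¹) := by
    have hd : (Rc R B0 Z).det ≠ 0 :=
      ((Matrix.isUnit_iff_isUnit_det _).1 hRcZ.isUnit).ne_zero
    have h1 : Tendsto (fun k => (Rc R B0 (X k)).det) atTop (nhds (Rc R B0 Z).det) :=
      ((continuous_id.matrix_det).tendsto _).comp hRt
    have h2 : Tendsto (fun k => (Rc R B0 (X k)).adjugate) atTop (nhds (Rc R B0 Z).adjugate) :=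
      ((continuous_id.matrix_adjugate).tendsto _).comp hRt
    simp only [Matrix.inv_def, Ring.inverse_eq_inv']
    exact (h1.inv₀ hd).smul h2
  have hLtt : Tendsto (fun k => (Lc L A0 B0 (X k))ᵀ) atTop (nhds (Lc L A0 B0 Z)ᵀ) :=
    ((continuous_id.matrix_transpose).tendsto _).comp hLt
  have hmul : ∀ {a b c : ℕ} {f : ℕ → Matrix (Fin a) (Fin b) ℝ} {g : ℕ → Matrix (Fin b) (Fin c) ℝ}
      {F : Matrix (Fin a) (Fin b) ℝ} {G : Matrix (Fin b) (Fin c) ℝ},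
      Tendsto f atTop (nhds F) → Tendsto g atTop (nhds G) →
      Tendsto (fun k => f k * g k) atTop (nhds (F * G)) := by
    intro a b c f g F G hf hg
    have hc : Continuous (fun p : Matrix (Fin a) (Fin b) ℝ × Matrix (Fin b) (Fin c) ℝ =>
      p.1 * p.2) := by fun_prop
    exact (hc.tendsto (F, G)).comp (hf.prodMk_nhds hg)
  have hAt : Tendsto (fun k => Ac A B L R A0 B0 (X k)) atTop (nhds (Ac A B L R A0 B0 Z)) :=
    tendsto_const_nhds.sub (hmul (hmul tendsto_const_nhds hRit) hLtt)
  have hGt : Tendsto (fun k => Gc B R B0 (X k)) atTop (nhds (Gc B R B0 Z)) :=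
    hmul (hmul tendsto_const_nhds hRit) tendsto_const_nhds
  have hHt : Tendsto (fun k => Hc Q L R A0 B0 (X k)) atTop (nhds (Hc Q L R A0 B0 Z)) :=
    hQt.sub (hmul (hmul hLt hRit) hLtt)
  have hAtt : Tendsto (fun k => (Ac A B L R A0 B0 (X k))ᵀ) atTop
      (nhds (Ac A B L R A0 B0 Z)ᵀ) :=
    ((continuous_id.matrix_transpose).tendsto _).comp hAt
  have hZ1 : Tendsto (fun k => X (k+1)) atTop (nhds Z) := hZ.comp (tendsto_add_atTop_nat 1)
  have hlim := ((((hmul hAtt hZ1).add (hmul hZ1 hAt)).sub (hmul (hmul hZ1 hGt) hZ1)).add hHt).add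
    (hmul (hmul (hZ1.sub hZ) hGt) (hZ1.sub hZ))
  have hres0 : scareRes A B Q L R A0 B0 Z = 0 := by
    rw [aux_res_eq A B Q L A0 B0 hRpd hZpsd]
    have h1 := tendsto_nhds_unique (hlim.congr hiter) tendsto_const_nhds
    simpa using h1
  rw [← huniq Z hZpsd hres0]
  exact hZ
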